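/- arXiv:1707.06883 — 2 statements merged into one kernel-verified Lean document; each statement's English description precedes it below -/
import Mathlib

section
/- Let X be a quasi-affine variety and Y any variety over ℂ. Then every morphism Y × X → X extends uniquely to a morphism Y × Spec O(X) → Spec O(X) via the canonical morphism X → Spec O(X). In particular, every regular action of an algebraic group on X extends to a regular action on Spec O(X). -/
open AlgebraicGeometry CategoryTheory Limits

namespace AlgebraicGeometry

universe u

/-- Every ring homomorphism out of the global sections of an integral one-point affine scheme
is flat. -/
lemma flat_of_subsingleton_of_isIntegral {S : Scheme.{u}} [IsAffine S] [IsIntegral S]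
    [Subsingleton S] {A : CommRingCat.{u}} (φ : Γ(S, ⊤) ⟶ A) : φ.hom.Flat := by
  have : Subsingleton (Spec Γ(S, ⊤)) := S.isoSpec.inv.homeomorph.injective.subsingleton
  exact Flat.SpecMap_iff.mp inferInstance

/-- Over an integral one-point affine scheme, global sections turn fibre products of
quasi-compact quasi-separated schemes into pushouts of rings. -/
lemma isPushout_appTop_of_subsingleton {P X Y S : Scheme.{u}} [IsAffine S] [IsIntegral S]
    [Subsingleton S] [CompactSpace X] [QuasiSeparatedSpace X] [CompactSpace Y]
    [QuasiSeparatedSpace Y] {p : P ⟶ X} {q : P ⟶ Y} {f : X ⟶ S} {g : Y ⟶ S}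
    (H : IsPullback p q f g) :
    IsPushout f.appTop g.appTop p.appTop q.appTop := by
  have := isIso_pushoutSection_of_isCompact_of_flat_right_of_ringHomFlat H
    (US := ⊤) (UT := ⊤) (UX := ⊤) (UY := ⊤) le_top le_top (by simp) (isAffineOpen_top S)
    isCompact_univ (by simpa using isQuasiSeparated_univ)
    isCompact_univ (by simpa using isQuasiSeparated_univ)
    (flat_of_subsingleton_of_isIntegral _)
  convert! (isIso_pushoutSection_iff ..).mp this using 1 <;> exact (Scheme.Hom.appLE_eq_app _).symm

/-- The base change of a morphism inducing an isomorphism on global sections again induces an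
isomorphism on global sections. -/
lemma isIso_appTop_pullbackMap {X X' Y S : Scheme.{u}} [IsAffine S] [IsIntegral S]
    [Subsingleton S] [CompactSpace X] [QuasiSeparatedSpace X] [CompactSpace X']
    [QuasiSeparatedSpace X'] [CompactSpace Y] [QuasiSeparatedSpace Y]
    (fY : Y ⟶ S) (f : X ⟶ S) (g : X' ⟶ S) (h : X ⟶ X') [IsIso h.appTop] (w : h ≫ g = f) :
    IsIso (pullback.map fY f fY g (𝟙 Y) h (𝟙 S) (by simp) (by simp [w])).appTop := by
  have H := isPushout_appTop_of_subsingleton (.of_hasPullback fY f)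
  have H' := isPushout_appTop_of_subsingleton (.of_hasPullback fY g)
  have H'' : IsPushout fY.appTop f.appTop (pullback.fst fY g).appTop
      (inv h.appTop ≫ (pullback.snd fY g).appTop) :=
    .of_iso H' (.refl _) (.refl _) (asIso h.appTop) (.refl _) (by simp)
      (by simp [← w]) (by simp) (by simp)
  have e : (H''.isoIsPushout _ _ H).hom =
      (pullback.map fY f fY g (𝟙 Y) h (𝟙 S) (by simp) (by simp [w])).appTop := by
    apply H''.hom_ext
    · rw [H''.inl_isoIsPushout_hom, ← Scheme.Hom.comp_appTop, pullback.lift_fst, Category.comp_id]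
    · rw [H''.inr_isoIsPushout_hom, Category.assoc, ← Scheme.Hom.comp_appTop, pullback.lift_snd,
        Scheme.Hom.comp_appTop, IsIso.inv_hom_id_assoc]
  exact e ▸ inferInstance

/-- A morphism inducing an isomorphism on global sections is orthogonal to affine schemes. -/
lemma existsUnique_comp_eq_of_isIso_appTop {P Q Z : Scheme.{u}} [IsAffine Z] (φ : P ⟶ Q)
    [IsIso φ.appTop] (f : P ⟶ Z) : ∃! G : Q ⟶ Z, φ ≫ G = f := by
  refine existsUnique_of_exists_of_unique
    ⟨Q.toSpecΓ ≫ Spec.map (inv φ.appTop) ≫ Spec.map f.appTop ≫ Z.isoSpec.inv, ?_⟩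
    fun G G' hG hG' ↦ ext_of_isAffine ?_
  · have : Spec.map φ.appTop ≫ Spec.map (inv φ.appTop) = 𝟙 _ := by
      rw [← Spec.map_comp, IsIso.inv_hom_id, Spec.map_id]
    simp only [Scheme.toSpecΓ_naturality_assoc, reassoc_of% this]
    rw [← Scheme.toSpecΓ_naturality_assoc, Scheme.toSpecΓ_isoSpec_inv, Category.comp_id]
  · rw [← cancel_mono φ.appTop, ← Scheme.Hom.comp_appTop, ← Scheme.Hom.comp_appTop, hG, hG']

end AlgebraicGeometry

/-- Let `X` be a quasi-affine complex variety and `Y` any complex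
variety. Every morphism `Y × X ⟶ X` extends uniquely to a morphism
`Y × Spec O(X) ⟶ Spec O(X)` along the canonical morphism `η : X ⟶ Spec O(X)`
(here `g : Spec Γ(X,⊤) ⟶ Spec ℂ` is the structure morphism, compatible with `η`). -/
theorem stmt_2 (X Y : Scheme)
    (fX : X ⟶ Spec (CommRingCat.of ℂ)) (fY : Y ⟶ Spec (CommRingCat.of ℂ))
    [IsReduced X] [IsReduced Y] [IsSeparated fX] [IsSeparated fY]
    [LocallyOfFiniteType fX] [LocallyOfFiniteType fY]
    [QuasiCompact fX] [QuasiCompact fY]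
    (hqa : ∃ (R : CommRingCat) (g : X ⟶ Spec R), IsOpenImmersion g)
    (g : Spec Γ(X, ⊤) ⟶ Spec (CommRingCat.of ℂ)) (hg : X.toSpecΓ ≫ g = fX)
    (F : pullback fY fX ⟶ X) :
    ∃! G : pullback fY g ⟶ Spec Γ(X, ⊤),
      pullback.map fY fX fY g (𝟙 Y) X.toSpecΓ (𝟙 _) (by simp) (by simp [hg]) ≫ G =
        F ≫ X.toSpecΓ := by
  have : CompactSpace X := QuasiCompact.compactSpace_of_compactSpace fX
  have : CompactSpace Y := QuasiCompact.compactSpace_of_compactSpace fY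
  have : QuasiSeparatedSpace X := quasiSeparatedSpace_of_quasiSeparated fX
  have : QuasiSeparatedSpace Y := quasiSeparatedSpace_of_quasiSeparated fY
  have : IsIso X.toSpecΓ.appTop := by rw [Scheme.toSpecΓ_appTop]; infer_instance
  have : Subsingleton (Spec (CommRingCat.of ℂ)) :=
    inferInstanceAs (Subsingleton (PrimeSpectrum ℂ))
  have := isIso_appTop_pullbackMap fY fX g X.toSpecΓ hg
  exact existsUnique_comp_eq_of_isIso_appTop _ _
end

section
/- Let X₁, X₂ be irreducible complex varieties. Then every invertible global regular function on X₁ × X₂ is a product f₁(x₁)·f₂(x₂) of invertible regular functions on X₁ and X₂; i.e., O(X₁ × X₂)* = O(X₁)*·O(X₂)*. -/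
open AlgebraicGeometry CategoryTheory Limits

open TensorProduct

theorem exists_algHom_apply_ne_zero {k B : Type*} [Field k] [IsAlgClosed k] [CommRing B]
    [IsReduced B] [Algebra k B] [Algebra.FiniteType k B] {b : B} (hb : b ≠ 0) :
    ∃ ψ : B →ₐ[k] k, ψ b ≠ 0 := by
  have hb' : ¬ IsNilpotent b := fun h ↦ hb h.eq_zero
  have : Nontrivial (Localization.Away b) := by
    rw [← not_subsingleton_iff_nontrivial]
    intro h
    rw [IsLocalization.subsingleton_iff (S := Localization.Away b) (M := Submonoid.powers b)] at h
    exact hb' h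
  obtain ⟨m, hm⟩ := Ideal.exists_maximal (Localization.Away b)
  have : Algebra.FiniteType B (Localization.Away b) :=
    IsLocalization.finiteType_of_monoid_fg (Submonoid.powers b) _
  have : Algebra.FiniteType k (Localization.Away b) := .trans (S := B) inferInstance inferInstance
  let := Ideal.Quotient.field m
  have : Algebra.FiniteType k (Localization.Away b ⧸ m) := inferInstance
  have : Module.Finite k (Localization.Away b ⧸ m) := finite_of_finite_type_of_isJacobsonRing _ _
  let e : k ≃ₐ[k] (Localization.Away b ⧸ m) := .ofBijective (Algebra.ofId _ _)
    (IsAlgClosed.algebraMap_bijective_of_isIntegral (k := k) (K := Localization.Away b ⧸ m))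
  let f : B →ₐ[k] k := e.symm.toAlgHom.comp
    ((Ideal.Quotient.mkₐ k m).comp (IsScalarTower.toAlgHom k B (Localization.Away b)))
  exact ⟨f, ((IsLocalization.Away.algebraMap_isUnit (S := Localization.Away b) b).map
    (e.symm.toAlgHom.comp (Ideal.Quotient.mkₐ k m))).ne_zero⟩

/-- The base change of a `k`-point of `B` to a `k`-algebra `A`. -/
noncomputable def evalRight {k B : Type*} (A : Type*) [Field k] [CommRing A] [Algebra k A]
    [CommRing B] [Algebra k B] (ψ : B →ₐ[k] k) : A ⊗[k] B →ₐ[A] A :=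
  (Algebra.TensorProduct.rid k A A).toAlgHom.comp
    (Algebra.TensorProduct.map (AlgHom.id A A) ψ)

@[simp]
theorem evalRight_tmul {k A B : Type*} [Field k] [CommRing A] [Algebra k A]
    [CommRing B] [Algebra k B] (ψ : B →ₐ[k] k) (a : A) (b : B) :
    evalRight A ψ (a ⊗ₜ b) = ψ b • a := by
  simp [evalRight]

/-- The base change of a `k`-point of `A` to a `k`-algebra `B`. -/
noncomputable def evalLeft {k A : Type*} (B : Type*) [Field k] [CommRing A] [Algebra k A]
    [CommRing B] [Algebra k B] (χ : A →ₐ[k] k) : A ⊗[k] B →ₐ[k] B :=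
  ((evalRight B χ).restrictScalars k).comp (Algebra.TensorProduct.comm k A B).toAlgHom

@[simp]
theorem evalLeft_tmul {k A B : Type*} [Field k] [CommRing A] [Algebra k A]
    [CommRing B] [Algebra k B] (χ : A →ₐ[k] k) (a : A) (b : B) :
    evalLeft B χ (a ⊗ₜ b) = χ a • b := by
  simp [evalLeft]

theorem isDomain_tensorProduct_of_isAlgClosed {k A B : Type*} [Field k] [IsAlgClosed k]
    [CommRing A] [IsDomain A] [Algebra k A]
    [CommRing B] [IsDomain B] [Algebra k B] [Algebra.FiniteType k B] :
    IsDomain (A ⊗[k] B) := by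
  have key (x : A ⊗[k] B) (hx : x ≠ 0) : ∃ b : B, b ≠ 0 ∧
      ∀ ψ : B →ₐ[k] k, evalRight A ψ x = 0 → ψ b = 0 := by
    let e := Module.Free.chooseBasis k A
    let E := Algebra.TensorProduct.basis B e
    let s := Algebra.TensorProduct.comm k A B
    have hs : s x ≠ 0 := by simpa using hx
    obtain ⟨i, hi⟩ := DFunLike.ne_iff.mp (E.repr.map_ne_zero_iff.mpr hs)
    refine ⟨E.repr (s x) i, by simpa using hi, fun ψ hψ ↦ ?_⟩
    have (z : A ⊗[k] B) : ψ (E.repr (s z) i) = e.repr (evalRight A ψ z) i := by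
      induction z with
      | zero => simp
      | add x y hx hy => simp [hx, hy]
      | tmul a b => simp [E, s, Algebra.TensorProduct.basis_repr_tmul]
    rw [this, hψ]
    simp
  have : NoZeroDivisors (A ⊗[k] B) := by
    refine ⟨fun {x y} hxy ↦ ?_⟩
    by_contra! h
    obtain ⟨b, hb, hb'⟩ := key x h.1
    obtain ⟨c, hc, hc'⟩ := key y h.2
    obtain ⟨ψ, hψ⟩ := exists_algHom_apply_ne_zero (k := k) (mul_ne_zero hb hc)
    rw [map_mul] at hψ
    have h0 : evalRight A ψ x * evalRight A ψ y = 0 := by rw [← map_mul, hxy, map_zero]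
    rcases mul_eq_zero.mp h0 with h | h
    · exact hψ (by rw [hb' ψ h, zero_mul])
    · exact hψ (by rw [hc' ψ h, mul_zero])
  exact NoZeroDivisors.to_isDomain _

section Valuation

variable {k F B V : Type*} [Field k] [Field F] [Algebra k F] [CommRing B] [Algebra k B]
  [CommRing V] [IsDomain V] [ValuationRing V] [Algebra k V] [Algebra V F] [IsFractionRing V F]
  [IsScalarTower k V F]

variable (k) in
theorem exists_smul_eq_of_valuationRing {z : F ⊗[k] B} (hz : z ≠ 0) :
    ∃ (a : F) (x : V ⊗[k] B),
      z = a • Algebra.TensorProduct.map (IsScalarTower.toAlgHom k V F) (AlgHom.id k B) x ∧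
      Algebra.TensorProduct.map (IsScalarTower.toAlgHom k V (IsLocalRing.ResidueField V))
        (AlgHom.id k B) x ≠ 0 := by
  let b := Module.Free.chooseBasis k B
  let E := Algebra.TensorProduct.basis F b
  let v := ValuationRing.valuation V F
  have hs : (E.repr z).support.Nonempty := by simpa using hz
  obtain ⟨j, hj, hmax⟩ := Finset.exists_max_image _ (fun i ↦ v (E.repr z i)) hs
  have hj0 : E.repr z j ≠ 0 := by simpa using hj
  have h1 (i) : ∃ c : V, algebraMap V F c = E.repr z i / E.repr z j := by
    rw [← ValuationRing.mem_integer_iff, Valuation.mem_integer_iff, map_div₀]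
    by_cases hi : i ∈ (E.repr z).support
    · exact div_le_one_of_le₀ (hmax i hi) zero_le
    · rw [Finsupp.notMem_support_iff.mp hi]; simp
  choose c hc using h1
  refine ⟨E.repr z j, ∑ i ∈ (E.repr z).support, c i ⊗ₜ b i, ?_, ?_⟩
  · conv_lhs => rw [← E.linearCombination_repr z]
    rw [Finsupp.linearCombination_apply, Finsupp.sum, map_sum, Finset.smul_sum]
    refine Finset.sum_congr rfl fun i _ ↦ ?_
    simp [E, hc, TensorProduct.smul_tmul', mul_div_cancel₀ _ hj0]
  · have hcj : c j = 1 := by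
      apply IsFractionRing.injective V F
      rw [hc, div_self hj0, map_one]
    intro h
    have := congr((Algebra.TensorProduct.basis (IsLocalRing.ResidueField V) b).repr $h j)
    simp [Algebra.TensorProduct.basis_repr_tmul, Finsupp.single_apply, hcj] at this
    simp_all

theorem exists_eq_smul_of_isUnit [IsAlgClosed k] [IsDomain B] [Algebra.FiniteType k B]
    (u : (F ⊗[k] B)ˣ) (ψ : B →ₐ[k] k) :
    ∃ x : V ⊗[k] B,
      Algebra.TensorProduct.map (IsScalarTower.toAlgHom k V F) (AlgHom.id k B) x =
        (evalRight F ψ u)⁻¹ • (u : F ⊗[k] B) := by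
  let φ := Algebra.TensorProduct.map (IsScalarTower.toAlgHom k V F) (AlgHom.id k B)
  let ρ := Algebra.TensorProduct.map (IsScalarTower.toAlgHom k V (IsLocalRing.ResidueField V))
        (AlgHom.id k B)
  have : IsDomain (F ⊗[k] B) := isDomain_tensorProduct_of_isAlgClosed
  have : IsDomain (IsLocalRing.ResidueField V ⊗[k] B) := isDomain_tensorProduct_of_isAlgClosed
  have hφ : Function.Injective φ := Module.Flat.rTensor_preserves_injective_linearMap
    (M := B) (IsScalarTower.toAlgHom k V F).toLinearMap (IsFractionRing.injective V F)
  have hφs (e : V) (x) : φ (e • x) = algebraMap V F e • φ x := by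
    induction x with
    | zero => simp
    | add x y hx hy => simp [hx, hy]
    | tmul a b => simp [φ, Algebra.smul_def]
  have hρs (e : V) (x) : ρ (e • x) = IsLocalRing.residue V e • ρ x := by
    induction x with
    | zero => simp
    | add x y hx hy => simp [hx, hy]
    | tmul a b => simp [ρ, TensorProduct.smul_tmul']
  have hev (x) : evalRight F ψ (φ x) = algebraMap V F (evalRight V ψ x) := by
    induction x with
    | zero => simp
    | add x y hx hy => simp [hx, hy]
    | tmul a b => simp [φ, Algebra.smul_def, ← IsScalarTower.algebraMap_apply]
  obtain ⟨a, x, hx, hx'⟩ := exists_smul_eq_of_valuationRing (V := V) k u.ne_zero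
  obtain ⟨c, y, hy, hy'⟩ := exists_smul_eq_of_valuationRing (V := V) k u⁻¹.ne_zero
  have huv : (a * c) • φ (x * y) = 1 := by
    rw [map_mul, ← u.mul_inv, hx, hy, smul_mul_smul_comm]
  have hxy : ρ (x * y) ≠ 0 := by rw [map_mul]; exact mul_ne_zero hx' hy'
  have hac : a * c ≠ 0 := by rintro h; simp [h] at huv
  have hunit : IsUnit (evalRight V ψ (x * y)) := by
    have aux : ∀ e : V, (e • (x * y) = 1 ∨ x * y = e • 1) → IsUnit (evalRight V ψ (x * y)) := by
      rintro e (he | he)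
      · have h := congr(evalRight V ψ $he)
        rw [map_smul, map_one, smul_eq_mul] at h
        exact .of_mul_eq_one_right _ h
      · have h : IsLocalRing.residue V e ≠ 0 := by
          intro h0
          rw [he, hρs, h0, zero_smul] at hxy
          exact hxy rfl
        rw [he, map_smul, map_one, smul_eq_mul, mul_one]
        exact (IsLocalRing.residue_ne_zero_iff_isUnit e).mp h
    rcases ValuationRing.isInteger_or_isInteger V (a * c) with ⟨e, he⟩ | ⟨e, he⟩
    · refine aux e (.inl (hφ ?_))
      rw [hφs, he, huv, map_one]
    · refine aux e (.inr (hφ ?_))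
      rw [hφs, he, map_one, ← huv, smul_smul, inv_mul_cancel₀ hac, one_smul]
  rw [map_mul] at hunit
  obtain ⟨e, he⟩ := isUnit_of_mul_isUnit_left hunit
  refine ⟨(e⁻¹ : Vˣ).1 • x, ?_⟩
  have ha : a ≠ 0 := left_ne_zero_of_mul hac
  change φ _ = _
  have he' : algebraMap V F (e⁻¹ : Vˣ).1 = (algebraMap V F e.1)⁻¹ := by
    apply eq_inv_of_mul_eq_one_left
    rw [← map_mul]
    simp
  rw [hφs, hx, map_smul, hev, ← he, he', smul_smul, smul_eq_mul, mul_inv_rev, mul_assoc,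
    inv_mul_cancel₀ ha, mul_one]

end Valuation

theorem mem_range_algebraMap_of_forall_valuationSubring {k F : Type*} [Field k] [IsAlgClosed k]
    [Field F] [Algebra k F] {x : F}
    (h : ∀ V : ValuationSubring F, (∀ c : k, algebraMap k F c ∈ V) → x ∈ V) :
    x ∈ (algebraMap k F).range := by
  have h1 : x ∈ (⨅ V : {V : ValuationSubring F // ((algebraMap k F).range : Set F) ⊆ V.toSubring},
      V.1.toSubring) := by
    rw [Subring.mem_iInf]
    exact fun V ↦ h V.1 fun c ↦ V.2 ⟨c, rfl⟩
  rw [iInf_valuationSubring_superset] at h1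
  have h2 : IsIntegral (Subring.closure ((algebraMap k F).range : Set F)) x := h1
  have h3 : IsIntegral k x := by
    obtain ⟨p, hp, hp'⟩ := h2
    have hr : (Subring.closure ((algebraMap k F).range : Set F)) = (algebraMap k F).range :=
      Subring.closure_eq _
    have : ∀ y : Subring.closure ((algebraMap k F).range : Set F), ∃ c : k, algebraMap k F c = y :=
      fun y ↦ hr.le y.2
    have hl : p.map (algebraMap _ F) ∈ Polynomial.lifts (algebraMap k F) := by
      rw [Polynomial.lifts_iff_coeff_lifts]
      intro n
      rw [Polynomial.coeff_map]
      exact this _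
    obtain ⟨q, hq, -, hqm⟩ := Polynomial.lifts_and_natDegree_eq_and_monic hl (hp.map _)
    refine ⟨q, hqm, ?_⟩
    rw [← Polynomial.eval_map, hq, Polynomial.eval_map, hp']
  exact minpoly.mem_range_of_degree_eq_one k x
    (IsAlgClosed.degree_eq_one_of_irreducible k (minpoly.irreducible h3))

theorem exists_eq_evalRight_tmul {k A B : Type*} [Field k] [IsAlgClosed k]
    [CommRing A] [IsDomain A] [Algebra k A]
    [CommRing B] [IsDomain B] [Algebra k B] [Algebra.FiniteType k B]
    (u : (A ⊗[k] B)ˣ) (ψ : B →ₐ[k] k) :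
    ∃ b : B, (u : A ⊗[k] B) = evalRight A ψ u ⊗ₜ b := by
  let F := FractionRing A
  let φ := Algebra.TensorProduct.map (IsScalarTower.toAlgHom k A F) (AlgHom.id k B)
  have hφ : Function.Injective φ := Module.Flat.rTensor_preserves_injective_linearMap
    (M := B) (IsScalarTower.toAlgHom k A F).toLinearMap (IsFractionRing.injective A F)
  have hev (x) : evalRight F ψ (φ x) = algebraMap A F (evalRight A ψ x) := by
    induction x with
    | zero => simp
    | add x y hx hy => simp [hx, hy]
    | tmul a b => simp [φ, Algebra.smul_def, ← IsScalarTower.algebraMap_apply]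
  let E := Algebra.TensorProduct.basis F (Module.Free.chooseBasis k B)
  let w := (evalRight F ψ (φ u))⁻¹ • φ u
  have hne : evalRight F ψ (φ u) ≠ 0 :=
    (u.isUnit.map (φ : A ⊗[k] B →+* F ⊗[k] B) |>.map (evalRight F ψ)).ne_zero
  have hw (i) : E.repr w i ∈ (algebraMap k F).range := by
    refine mem_range_algebraMap_of_forall_valuationSubring fun V hV ↦ ?_
    let : Algebra k V := ((algebraMap k F).codRestrict V.toSubring hV).toAlgebra
    have : IsScalarTower k V F := .of_algebraMap_eq fun _ ↦ rfl
    obtain ⟨x, hx⟩ := exists_eq_smul_of_isUnit (V := V) (Units.map (φ : A ⊗[k] B →* F ⊗[k] B) u) ψ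
    have (x : V ⊗[k] B) : E.repr (Algebra.TensorProduct.map (IsScalarTower.toAlgHom k V F)
        (AlgHom.id k B) x) i ∈ V := by
      induction x with
      | zero => simp
      | add x y hx hy => simpa using add_mem hx hy
      | tmul a b =>
        simp only [Algebra.TensorProduct.map_tmul, E, Algebra.TensorProduct.basis_repr_tmul]
        simpa [Algebra.smul_def] using mul_mem a.2 (hV _)
    have h2 := this x
    rw [hx] at h2
    exact h2
  choose c hc using hw
  obtain ⟨b, hb⟩ : ∃ b : B, w = 1 ⊗ₜ b := by
    refine ⟨∑ i ∈ (E.repr w).support, c i • Module.Free.chooseBasis k B i, ?_⟩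
    conv_lhs => rw [← E.linearCombination_repr w]
    rw [Finsupp.linearCombination_apply, Finsupp.sum, TensorProduct.tmul_sum]
    refine Finset.sum_congr rfl fun i _ ↦ ?_
    rw [← hc i, Algebra.TensorProduct.basis_apply, TensorProduct.smul_tmul', smul_eq_mul, mul_one,
      TensorProduct.tmul_smul, TensorProduct.smul_tmul', Algebra.smul_def, mul_one]
  refine ⟨b, hφ ?_⟩
  have : φ u = evalRight F ψ (φ u) • w := by
    rw [smul_smul, mul_inv_cancel₀ hne, one_smul]
  rw [this, hb, hev]
  simp [φ, Algebra.smul_def]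


universe v

theorem isDominant_of_isOpenImmersion {X Y : Scheme} [IrreducibleSpace Y] [Nonempty X]
    (j : X ⟶ Y) [IsOpenImmersion j] : IsDominant j :=
  ⟨j.isOpenEmbedding.isOpen_range.dense (Set.range_nonempty _)⟩

/-- The values on `Spec R` of the global functions of a scheme. -/
noncomputable def valuesOnSpec {P : Scheme.{v}} {R : Type v} [CommRing R]
    (h : Spec (.of R) ⟶ P) : Γ(P, ⊤) →+* R :=
  (Scheme.ΓSpecIso (.of R)).hom.hom.comp h.appTop.hom

theorem valuesOnSpec_comp {P Q : Scheme.{v}} {R : Type v} [CommRing R]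
    (h : Spec (.of R) ⟶ P) (g : P ⟶ Q) (s : Γ(Q, ⊤)) :
    valuesOnSpec (h ≫ g) s = valuesOnSpec h (g.appTop s) := by
  simp only [valuesOnSpec, Scheme.Hom.comp_appTop]
  rfl

theorem valuesOnSpec_specMap_comp {P : Scheme.{v}} {R S : Type v} [CommRing R] [CommRing S]
    (φ : R →+* S) (h : Spec (.of R) ⟶ P) (s : Γ(P, ⊤)) :
    valuesOnSpec (Spec.map (CommRingCat.ofHom φ) ≫ h) s = φ (valuesOnSpec h s) := by
  have := congr($(Scheme.ΓSpecIso_naturality (CommRingCat.ofHom φ)) (h.appTop s))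
  rw [valuesOnSpec, Scheme.Hom.comp_appTop]
  exact this

theorem exists_affine_chart {k : Type v} [Field k] {X : Scheme.{v}} [IsIntegral X]
    (f : X ⟶ Spec (.of k)) [LocallyOfFiniteType f] :
    ∃ (A : Type v) (_ : CommRing A) (_ : IsDomain A) (_ : Algebra k A)
      (_ : Algebra.FiniteType k A) (j : Spec (.of A) ⟶ X), IsOpenImmersion j ∧
      j ≫ f = Spec.map (CommRingCat.ofHom (algebraMap k A)) := by
  obtain ⟨x⟩ := (inferInstance : Nonempty X)
  obtain ⟨U, hU, hxU, -⟩ :=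
    X.isBasis_affineOpens.exists_subset_of_mem_open (Set.mem_univ x) isOpen_univ
  obtain ⟨U, hU : IsAffineOpen U, rfl⟩ := hU
  have : Nonempty U := ⟨⟨x, hxU⟩⟩
  let φ := Spec.preimage (hU.fromSpec ≫ f)
  have hφ : Spec.map φ = hU.fromSpec ≫ f := Spec.map_preimage _
  have hft : φ.hom.FiniteType := by
    rw [← HasRingHomProperty.Spec_iff (P := @LocallyOfFiniteType), hφ]
    infer_instance
  let : Algebra k Γ(X, U) := φ.hom.toAlgebra
  exact ⟨Γ(X, U), inferInstance, inferInstance, inferInstance, hft, hU.fromSpec, inferInstance,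
    hφ.symm⟩

/-- The chart of a fibre product over a field given by charts of the factors. -/
noncomputable def prodChart {k : Type v} [Field k] {X Y : Scheme.{v}}
    (f : X ⟶ Spec (.of k)) (g : Y ⟶ Spec (.of k)) {A B : Type v} [CommRing A] [CommRing B]
    [Algebra k A] [Algebra k B] (i : Spec (.of A) ⟶ X) (j : Spec (.of B) ⟶ Y)
    (hi : i ≫ f = Spec.map (CommRingCat.ofHom (algebraMap k A)))
    (hj : j ≫ g = Spec.map (CommRingCat.ofHom (algebraMap k B))) :
    Spec (.of (A ⊗[k] B)) ⟶ pullback f g :=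
  pullback.lift
    (Spec.map (CommRingCat.ofHom (Algebra.TensorProduct.includeLeft (R := k) (S := k) (A := A)
      (B := B)).toRingHom) ≫ i)
    (Spec.map (CommRingCat.ofHom (Algebra.TensorProduct.includeRight (R := k) (A := A)
      (B := B)).toRingHom) ≫ j)
    (by
      rw [Category.assoc, Category.assoc, hi, hj, ← Spec.map_comp, ← Spec.map_comp,
        ← CommRingCat.ofHom_comp, ← CommRingCat.ofHom_comp]
      congr 2
      ext c
      simp)

section

variable {k : Type v} [Field k] {X Y : Scheme.{v}}
    {f : X ⟶ Spec (.of k)} {g : Y ⟶ Spec (.of k)} {A B : Type v} [CommRing A] [CommRing B]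
    [Algebra k A] [Algebra k B] {i : Spec (.of A) ⟶ X} {j : Spec (.of B) ⟶ Y}
    (hi : i ≫ f = Spec.map (CommRingCat.ofHom (algebraMap k A)))
    (hj : j ≫ g = Spec.map (CommRingCat.ofHom (algebraMap k B)))

theorem valuesOnSpec_prodChart_injective [IsIntegral X] [IsIntegral Y]
    [IsSeparated f] [IsSeparated g] [IsOpenImmersion i] [IsOpenImmersion j]
    [Nontrivial A] [Nontrivial B] :
    Function.Injective (valuesOnSpec (prodChart f g i j hi hj)) := by
  have : IsDominant i := isDominant_of_isOpenImmersion i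
  have : IsDominant j := isDominant_of_isOpenImmersion j
  have : IsSchemeTheoreticallyDominant i := .of_isDominant i
  have : IsSchemeTheoreticallyDominant j := .of_isDominant j
  have : QuasiCompact i := by
    have : QuasiCompact (i ≫ f) := by rw [hi]; infer_instance
    exact .of_comp i f
  have : QuasiCompact j := by
    have : QuasiCompact (j ≫ g) := by rw [hj]; infer_instance
    exact .of_comp j g
  let p := pullback.snd i (pullback.fst f g)
  let q := pullback.fst (p ≫ pullback.snd f g) j
  have hq : Function.Injective (q ≫ p).appTop := Scheme.Hom.app_injective (q ≫ p) ⊤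
  let r : pullback (p ≫ pullback.snd f g) j ⟶ Spec (.of (A ⊗[k] B)) :=
    pullback.lift (q ≫ pullback.fst _ _) (pullback.snd _ _) (by
      rw [← hi, ← hj]
      have h1 : pullback.fst i (pullback.fst f g) ≫ i ≫ f = p ≫ pullback.snd f g ≫ g := by
        rw [pullback.condition_assoc, pullback.condition]
      have h2 : q ≫ p ≫ pullback.snd f g = pullback.snd _ _ ≫ j := by
        rw [← pullback.condition]
      rw [Category.assoc, h1, ← Category.assoc p, ← Category.assoc q, h2, Category.assoc]) ≫
      (pullbackSpecIso k A B).hom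
  have hr : r ≫ prodChart f g i j hi hj = q ≫ p := by
    apply pullback.hom_ext
    · have h := pullbackSpecIso_hom_fst_assoc k A B i
      simp only [r, prodChart, Category.assoc, pullback.lift_fst]
      refine congr(pullback.lift _ _ _ ≫ $h).trans ?_
      rw [pullback.lift_fst_assoc, Category.assoc, pullback.condition]
    · have h := pullbackSpecIso_hom_snd_assoc k A B j
      simp only [r, prodChart, Category.assoc, pullback.lift_snd]
      refine congr(pullback.lift _ _ _ ≫ $h).trans ?_
      rw [pullback.lift_snd_assoc, ← pullback.condition]
  rw [← hr, Scheme.Hom.comp_appTop] at hq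
  have h2 : Function.Injective (prodChart f g i j hi hj).appTop := by
    apply Function.Injective.of_comp (f := r.appTop)
    simpa using hq
  exact ((Scheme.ΓSpecIso (.of (A ⊗[k] B))).commRingCatIsoToRingEquiv.injective).comp h2

theorem specMap_comp_prodChart_left (ψ : B →ₐ[k] k) (h) :
    Spec.map (CommRingCat.ofHom (evalRight A ψ).toRingHom) ≫ prodChart f g i j hi hj =
      i ≫ pullback.lift (𝟙 X) (f ≫ Spec.map (CommRingCat.ofHom ψ.toRingHom) ≫ j) h := by
  apply pullback.hom_ext
  · simp only [prodChart, Category.assoc, pullback.lift_fst]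
    rw [← Category.assoc, ← Spec.map_comp, ← CommRingCat.ofHom_comp, Category.comp_id]
    convert Category.id_comp i
    rw [← Spec.map_id]
    congr 1
    ext a
    simp
  · simp only [prodChart, Category.assoc, pullback.lift_snd]
    rw [← Category.assoc, ← Category.assoc i, ← Category.assoc (i ≫ f), hi, ← Spec.map_comp,
      ← Spec.map_comp, ← CommRingCat.ofHom_comp, ← CommRingCat.ofHom_comp]
    congr 3
    ext b
    simp [Algebra.smul_def]

theorem specMap_comp_prodChart_right (χ : A →ₐ[k] k) (h) :
    Spec.map (CommRingCat.ofHom (evalLeft B χ).toRingHom) ≫ prodChart f g i j hi hj =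
      j ≫ pullback.lift (g ≫ Spec.map (CommRingCat.ofHom χ.toRingHom) ≫ i) (𝟙 Y) h := by
  apply pullback.hom_ext
  · simp only [prodChart, Category.assoc, pullback.lift_fst]
    rw [← Category.assoc, ← Category.assoc j, ← Category.assoc (j ≫ g), hj, ← Spec.map_comp,
      ← Spec.map_comp, ← CommRingCat.ofHom_comp, ← CommRingCat.ofHom_comp]
    congr 3
    ext a
    simp [Algebra.smul_def]
  · simp only [prodChart, Category.assoc, pullback.lift_snd]
    rw [← Category.assoc, ← Spec.map_comp, ← CommRingCat.ofHom_comp, Category.comp_id]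
    convert Category.id_comp j
    rw [← Spec.map_id]
    congr 1
    ext a
    simp

end

theorem specMap_algHom_comp {k : Type v} [Field k] {X : Scheme.{v}} {f : X ⟶ Spec (.of k)}
    {A : Type v} [CommRing A] [Algebra k A] {i : Spec (.of A) ⟶ X}
    (hi : i ≫ f = Spec.map (CommRingCat.ofHom (algebraMap k A))) (χ : A →ₐ[k] k) :
    (Spec.map (CommRingCat.ofHom χ.toRingHom) ≫ i) ≫ f = 𝟙 _ := by
  rw [Category.assoc, hi, ← Spec.map_comp, ← CommRingCat.ofHom_comp, ← Spec.map_id]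
  congr 1
  ext c
  simp

theorem exists_unit_eq_appTop_mul_appTop {k : Type v} [Field k] [IsAlgClosed k] {X Y : Scheme.{v}}
    (f : X ⟶ Spec (.of k)) (g : Y ⟶ Spec (.of k)) [IsIntegral X] [IsIntegral Y]
    [IsSeparated f] [IsSeparated g] [LocallyOfFiniteType f] [LocallyOfFiniteType g]
    (u : Γ(pullback f g, ⊤)ˣ) :
    ∃ (u₁ : Γ(X, ⊤)ˣ) (u₂ : Γ(Y, ⊤)ˣ), (u : Γ(pullback f g, ⊤)) =
      (pullback.fst f g).appTop u₁ * (pullback.snd f g).appTop u₂ := by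
  obtain ⟨A, _, _, _, _, i, _, hi⟩ := exists_affine_chart f
  obtain ⟨B, _, _, _, _, j, _, hj⟩ := exists_affine_chart g
  obtain ⟨χ, -⟩ := exists_algHom_apply_ne_zero (k := k) (one_ne_zero (α := A))
  obtain ⟨ψ, -⟩ := exists_algHom_apply_ne_zero (k := k) (one_ne_zero (α := B))
  let J := prodChart f g i j hi hj
  let s : X ⟶ pullback f g := pullback.lift (𝟙 X)
    (f ≫ Spec.map (CommRingCat.ofHom ψ.toRingHom) ≫ j)
    (by rw [Category.assoc, specMap_algHom_comp hj ψ, Category.comp_id, Category.id_comp])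
  let t : Y ⟶ pullback f g := pullback.lift
    (g ≫ Spec.map (CommRingCat.ofHom χ.toRingHom) ≫ i) (𝟙 Y)
    (by rw [Category.assoc, specMap_algHom_comp hi χ, Category.comp_id, Category.id_comp])
  let u₁ := Units.map s.appTop.hom.toMonoidHom u
  let w := u * (Units.map (pullback.fst f g).appTop.hom.toMonoidHom u₁)⁻¹
  let u₂ := Units.map t.appTop.hom.toMonoidHom w
  have hfst (x) : valuesOnSpec J ((pullback.fst f g).appTop x) = valuesOnSpec i x ⊗ₜ[k] 1 := by
    rw [← valuesOnSpec_comp, show J ≫ pullback.fst f g = _ from pullback.lift_fst _ _ _,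
      valuesOnSpec_specMap_comp]
    rfl
  have hsnd (x) : valuesOnSpec J ((pullback.snd f g).appTop x) = 1 ⊗ₜ[k] valuesOnSpec j x := by
    rw [← valuesOnSpec_comp, show J ≫ pullback.snd f g = _ from pullback.lift_snd _ _ _,
      valuesOnSpec_specMap_comp]
    rfl
  have hs (x) : valuesOnSpec i (s.appTop x) = evalRight A ψ (valuesOnSpec J x) := by
    rw [← valuesOnSpec_comp, ← specMap_comp_prodChart_left hi hj, valuesOnSpec_specMap_comp]
    rfl
  have ht (x) : valuesOnSpec j (t.appTop x) = evalLeft B χ (valuesOnSpec J x) := by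
    rw [← valuesOnSpec_comp, ← specMap_comp_prodChart_right hi hj, valuesOnSpec_specMap_comp]
    rfl
  have hu₁ : valuesOnSpec J ((pullback.fst f g).appTop u₁) =
      evalRight A ψ (valuesOnSpec J u) ⊗ₜ[k] 1 := by
    rw [hfst, ← hs]
    rfl
  obtain ⟨b, hb⟩ := exists_eq_evalRight_tmul (Units.map (valuesOnSpec J).toMonoidHom u) ψ
  replace hb : valuesOnSpec J u = evalRight A ψ (valuesOnSpec J u) ⊗ₜ[k] b := hb
  have huw : (u : Γ(pullback f g, ⊤)) = (pullback.fst f g).appTop u₁ * w := by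
    change u.1 = (Units.map (pullback.fst f g).appTop.hom.toMonoidHom u₁).1 * w.1
    rw [← Units.val_mul, mul_mul_inv_cancel'_right]
  have hw : valuesOnSpec J w = 1 ⊗ₜ[k] b := by
    refine (((u₁.isUnit.map (pullback.fst f g).appTop.hom).map (valuesOnSpec J)).mul_left_cancel ?_)
    rw [← map_mul]
    refine congr(valuesOnSpec J $huw).symm.trans (hb.trans ?_)
    refine Eq.trans ?_ congr($hu₁.symm * (1 ⊗ₜ[k] b))
    simp
  refine ⟨u₁, u₂, valuesOnSpec_prodChart_injective hi hj ?_⟩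
  rw [map_mul]
  change valuesOnSpec J _ = valuesOnSpec J _ * valuesOnSpec J _
  have hu₂ : valuesOnSpec j u₂ = χ 1 • b := by
    rw [← evalLeft_tmul, ← hw, ← ht]
    rfl
  rw [hu₁, hsnd, hu₂, map_one, one_smul, Algebra.TensorProduct.tmul_mul_tmul, one_mul, mul_one]
  exact hb

/-- **Rosenlicht.** For irreducible (integral) complex varieties `X₁`, `X₂`,
every invertible global regular function on `X₁ × X₂` is a product of pullbacks of
invertible regular functions on the two factors. -/
theorem stmt_7 (X₁ X₂ : Scheme)
    (f₁ : X₁ ⟶ Spec (CommRingCat.of ℂ)) (f₂ : X₂ ⟶ Spec (CommRingCat.of ℂ))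
    [IsIntegral X₁] [IsIntegral X₂] [IsSeparated f₁] [IsSeparated f₂]
    [LocallyOfFiniteType f₁] [LocallyOfFiniteType f₂]
    [QuasiCompact f₁] [QuasiCompact f₂]
    (u : Γ(pullback f₁ f₂, ⊤)ˣ) :
    ∃ (u₁ : Γ(X₁, ⊤)ˣ) (u₂ : Γ(X₂, ⊤)ˣ),
      (u : Γ(pullback f₁ f₂, ⊤)) =
        (pullback.fst f₁ f₂).appTop u₁ * (pullback.snd f₁ f₂).appTop u₂ := by
  exact exists_unit_eq_appTop_mul_appTop f₁ f₂ u
end
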